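/- Let p ∈ (2,6] and ℓ > 0. There exists μ₂ > 0 such that for every μ ∈ (0, μ₂) and every continuously differentiable function u : ℝ → ℂ with ∫₀^ℓ |u(x)|² dx = μ, one has (1/2)∫₀^ℓ |u'(x)|² dx − (1/p)∫₀^ℓ |u(x)|^p dx ≥ −(ℓ/p)·(μ/ℓ)^(p/2); that is, the energy of u is at least the energy E(κ_μ) = −(ℓ/p)(μ/ℓ)^(p/2) of the constant function κ_μ = √(μ/ℓ), so the constant is a ground state of mass μ. -/

import Mathlib

open Real MeasureTheory intervalIntegral

/-- The Cauchy–Schwarz inequality for continuous real functions on an interval. -/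
lemma sq_integral_mul_le {a b : ℝ} (hab : a ≤ b) {f g : ℝ → ℝ}
    (hf : Continuous f) (hg : Continuous g) :
    (∫ x in a..b, f x * g x) ^ 2 ≤ (∫ x in a..b, f x ^ 2) * ∫ x in a..b, g x ^ 2 := by
  have key : ∀ s : ℝ, 0 ≤ (∫ x in a..b, f x ^ 2) * (s * s)
      + (2 * ∫ x in a..b, f x * g x) * s + ∫ x in a..b, g x ^ 2 := by
    intro s
    have h : 0 ≤ ∫ x in a..b, (s * f x + g x) ^ 2 :=
      integral_nonneg hab fun x _ => sq_nonneg _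
    have e : (∫ x in a..b, (s * f x + g x) ^ 2)
        = ∫ x in a..b, ((s * s) * f x ^ 2 + (2 * s) * (f x * g x) + g x ^ 2) :=
      integral_congr fun x _ => by ring
    rw [e, intervalIntegral.integral_add, intervalIntegral.integral_add,
      intervalIntegral.integral_const_mul, intervalIntegral.integral_const_mul] at h
    · linarith
    all_goals exact Continuous.intervalIntegrable (by fun_prop) _ _
  have := discrim_le_zero key
  unfold discrim at this
  linarith

/-- On `[0, ℓ]`, the oscillation of `‖u‖ ^ 2` is controlled by the mass and the kinetic energy. -/
lemma sq_sub_norm_sq_le {ℓ : ℝ} {u : ℝ → ℂ} (hu : ContDiff ℝ 1 u) {x y : ℝ}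
    (hx : x ∈ Set.Icc 0 ℓ) (hy : y ∈ Set.Icc 0 ℓ) :
    (‖u x‖ ^ 2 - ‖u y‖ ^ 2) ^ 2
      ≤ 4 * ((∫ t in (0:ℝ)..ℓ, ‖u t‖ ^ 2) * ∫ t in (0:ℝ)..ℓ, ‖deriv u t‖ ^ 2) := by
  have hℓ : 0 ≤ ℓ := hx.1.trans hx.2
  have hc : Continuous u := hu.continuous
  have hd : Continuous (deriv u) := hu.continuous_deriv le_rfl
  have hderiv : ∀ t, HasDerivAt (fun t => ‖u t‖ ^ 2) (2 * inner ℝ (u t) (deriv u t)) t :=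
    fun t => (hu.differentiable one_ne_zero t).hasDerivAt.norm_sq
  have hftc : ∫ t in y..x, 2 * inner ℝ (u t) (deriv u t) = ‖u x‖ ^ 2 - ‖u y‖ ^ 2 :=
    integral_eq_sub_of_hasDerivAt (fun t _ => hderiv t)
      (Continuous.intervalIntegrable (by fun_prop) _ _)
  have hcs := sq_integral_mul_le hℓ hc.norm hd.norm
  have hbound : |‖u x‖ ^ 2 - ‖u y‖ ^ 2| ≤ 2 * ∫ t in (0:ℝ)..ℓ, ‖u t‖ * ‖deriv u t‖ := by
    rw [← hftc, ← Real.norm_eq_abs, ← intervalIntegral.integral_const_mul,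
      intervalIntegral.integral_of_le hℓ]
    refine norm_integral_le_integral_norm_uIoc.trans ?_
    refine (setIntegral_mono_on (g := fun t => 2 * (‖u t‖ * ‖deriv u t‖)) ?_ ?_
      measurableSet_uIoc ?_).trans (setIntegral_mono_set ?_ ?_ ?_)
    · exact Continuous.integrableOn_uIoc (by fun_prop)
    · exact Continuous.integrableOn_uIoc (by fun_prop)
    · intro t _
      have := norm_inner_le_norm (𝕜 := ℝ) (u t) (deriv u t)
      rw [norm_mul, Real.norm_two]
      linarith
    · exact Continuous.integrableOn_Ioc (by fun_prop)
    · exact Filter.Eventually.of_forall fun t => by simp only [Pi.zero_apply]; positivity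
    · refine LE.le.eventuallyLE ?_
      exact Set.Ioc_subset_Ioc (le_min hy.1 hx.1) (max_le hy.2 hx.2)
  rw [← sq_abs]
  calc |‖u x‖ ^ 2 - ‖u y‖ ^ 2| ^ 2
      ≤ (2 * ∫ t in (0:ℝ)..ℓ, ‖u t‖ * ‖deriv u t‖) ^ 2 := by gcongr
    _ ≤ _ := by rw [mul_pow]; linarith

/-- The critical case: the excess of `∫ ‖u‖ ^ 6` over its value at the constant function of the
same mass is controlled by the kinetic energy. -/
lemma integral_norm_pow_six_le {ℓ : ℝ} (hℓ : 0 < ℓ) {u : ℝ → ℂ} (hu : ContDiff ℝ 1 u) {m : ℝ}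
    (hm : 0 ≤ m) (hmass : ∫ x in (0:ℝ)..ℓ, ‖u x‖ ^ 2 = ℓ * m) :
    ∫ x in (0:ℝ)..ℓ, (‖u x‖ ^ 2) ^ 3
      ≤ ℓ * m ^ 3 + 12 * (ℓ * m) ^ 2 * ∫ x in (0:ℝ)..ℓ, ‖deriv u x‖ ^ 2 := by
  have hc : Continuous u := hu.continuous
  set D := ∫ x in (0:ℝ)..ℓ, ‖deriv u x‖ ^ 2 with hD
  obtain ⟨y, hy, hym⟩ : ∃ y ∈ Set.Icc 0 ℓ, ‖u y‖ ^ 2 = m := by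
    obtain ⟨y, hy, hym⟩ := exists_eq_interval_average (f := fun x => ‖u x‖ ^ 2) hℓ.ne
      (by fun_prop)
    rw [Set.uIoo_of_lt hℓ] at hy
    refine ⟨y, Set.Ioo_subset_Icc_self hy, ?_⟩
    rw [interval_average_eq_div, hmass] at hym
    rw [hym, sub_zero, mul_div_cancel_left₀ _ hℓ.ne']
  have hpt : ∀ x ∈ Set.Icc 0 ℓ, (‖u x‖ ^ 2) ^ 3
      ≤ (3 * m ^ 2 + 4 * (ℓ * m * D)) * ‖u x‖ ^ 2 + (8 * (ℓ * m * D) * m - 2 * m ^ 3) := by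
    intro x hx
    have h := sq_sub_norm_sq_le hu hx hy
    rw [hmass, hym, ← hD] at h
    have := mul_le_mul_of_nonneg_right h (by positivity : 0 ≤ ‖u x‖ ^ 2 + 2 * m)
    linarith
  have h := integral_mono_on (μ := volume) hℓ.le
    (Continuous.intervalIntegrable (by fun_prop) _ _)
    (Continuous.intervalIntegrable (by fun_prop) _ _) hpt
  rw [intervalIntegral.integral_add, intervalIntegral.integral_const_mul, hmass,
    intervalIntegral.integral_const, smul_eq_mul] at h
  · linarith
  all_goals exact Continuous.intervalIntegrable (by fun_prop) _ _

/-- Interpolation of the power `p ∈ [2, 6]` between `2` and `6`, normalized at `‖z‖ ^ 2 = m`. -/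
lemma rpow_le_interpolation {p m s : ℝ} (hp : 2 ≤ p) (hp6 : p ≤ 6) (hm : 0 < m) (hs : 0 ≤ s) :
    s ^ p ≤ m ^ (p / 2) * ((6 - p) / (4 * m) * s ^ 2 + (p - 2) / (4 * m ^ 3) * (s ^ 2) ^ 3) := by
  have ht : 0 ≤ s ^ 2 / m := by positivity
  have h := Real.geom_mean_le_arith_mean2_weighted (w₁ := (6 - p) / 4) (w₂ := (p - 2) / 4)
    (by linarith) (by linarith) ht (pow_nonneg ht 3) (by ring)
  have e : (s ^ 2 / m) ^ ((6 - p) / 4) * ((s ^ 2 / m) ^ 3) ^ ((p - 2) / 4)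
      = (s ^ 2 / m) ^ (p / 2) := by
    rw [← Real.rpow_natCast (s ^ 2 / m) 3, ← Real.rpow_mul ht,
      ← Real.rpow_add_of_nonneg ht (by linarith) (by push_cast; linarith)]
    congr 1
    push_cast
    ring
  have e2 : s ^ p = m ^ (p / 2) * (s ^ 2 / m) ^ (p / 2) := by
    rw [← Real.mul_rpow hm.le ht, mul_div_cancel₀ _ hm.ne', ← Real.rpow_natCast s 2,
      ← Real.rpow_mul hs]
    congr 1
    push_cast
    ring
  rw [e2, ← e]
  refine mul_le_mul_of_nonneg_left (h.trans (le_of_eq ?_)) (by positivity)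
  field_simp

/-- Theorem 2 of the paper on the single-edge graph `[0, ℓ]`: there exists `μ₂ > 0`
such that for every mass `μ < μ₂`, the constant function `κ_μ = √(μ/ℓ)` is a ground
state, i.e. every function of mass `μ` has energy at least
`E(κ_μ) = -(ℓ/p)(μ/ℓ)^(p/2)`. -/
theorem stmt10 (p ℓ : ℝ) (hp : 2 < p) (hp6 : p ≤ 6) (hℓ : 0 < ℓ) :
    ∃ μ₂ > 0, ∀ μ : ℝ, 0 < μ → μ < μ₂ →
      ∀ u : ℝ → ℂ, ContDiff ℝ 1 u → (∫ x in (0:ℝ)..ℓ, ‖u x‖ ^ 2) = μ →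
        (1/2) * (∫ x in (0:ℝ)..ℓ, ‖deriv u x‖ ^ 2)
            - (1/p) * (∫ x in (0:ℝ)..ℓ, ‖u x‖ ^ p)
          ≥ -(ℓ/p) * (μ/ℓ) ^ (p/2) := by
  refine ⟨ℓ * (1 / (6 * ℓ ^ 2)) ^ (p / 2 - 1)⁻¹, by positivity, ?_⟩
  intro μ hμ hμ₂ u hu hmass
  have hc : Continuous u := hu.continuous
  obtain ⟨m, hm⟩ : ∃ m, m = μ / ℓ := ⟨_, rfl⟩
  have hm0 : 0 < m := hm ▸ div_pos hμ hℓ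
  have hμm : μ = ℓ * m := by rw [hm]; field_simp
  rw [← hm]
  rw [hμm] at hmass hμ₂
  have hsmall : 6 * ℓ ^ 2 * m ^ (p / 2 - 1) ≤ 1 := by
    have h1 : m ≤ (1 / (6 * ℓ ^ 2)) ^ (p / 2 - 1)⁻¹ := (lt_of_mul_lt_mul_left hμ₂ hℓ.le).le
    have h2 := Real.rpow_le_rpow hm0.le h1 (by linarith : 0 ≤ p / 2 - 1)
    rw [Real.rpow_inv_rpow (by positivity) (by linarith), le_div_iff₀ (by positivity)] at h2
    linarith
  have hsix := integral_norm_pow_six_le hℓ hu hm0.le hmass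
  have hD : 0 ≤ ∫ x in (0:ℝ)..ℓ, ‖deriv u x‖ ^ 2 :=
    integral_nonneg hℓ.le fun x _ => by positivity
  have hint := integral_mono_on (μ := volume) (a := 0) (b := ℓ) hℓ.le
    (Continuous.intervalIntegrable (hc.norm.rpow_const fun _ => Or.inr (by linarith)) _ _)
    (Continuous.intervalIntegrable (by fun_prop) _ _)
    (fun x _ => rpow_le_interpolation hp.le hp6 hm0 (norm_nonneg (u x)))
  rw [intervalIntegral.integral_const_mul, intervalIntegral.integral_add,
    intervalIntegral.integral_const_mul, intervalIntegral.integral_const_mul, hmass] at hint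
  rotate_left
  · exact Continuous.intervalIntegrable (by fun_prop) _ _
  · exact Continuous.intervalIntegrable (by fun_prop) _ _
  set D := ∫ x in (0:ℝ)..ℓ, ‖deriv u x‖ ^ 2
  set S := ∫ x in (0:ℝ)..ℓ, (‖u x‖ ^ 2) ^ 3
  have hpow : m ^ (p / 2) = m * m ^ (p / 2 - 1) := by
    rw [Real.rpow_sub_one hm0.ne']
    field_simp
  have hmain : ∫ x in (0:ℝ)..ℓ, ‖u x‖ ^ p ≤ ℓ * m ^ (p / 2) + p / 2 * D := by
    calc ∫ x in (0:ℝ)..ℓ, ‖u x‖ ^ p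
        ≤ m ^ (p / 2) * ((6 - p) / (4 * m) * (ℓ * m)
            + (p - 2) / (4 * m ^ 3) * (ℓ * m ^ 3 + 12 * (ℓ * m) ^ 2 * D)) := by
          refine hint.trans ?_
          have : 0 ≤ (p - 2) / (4 * m ^ 3) := div_nonneg (by linarith) (by positivity)
          gcongr
      _ = ℓ * m ^ (p / 2) + (p - 2) / 2 * (6 * ℓ ^ 2 * m ^ (p / 2 - 1)) * D := by
          rw [hpow]
          field_simp
          ring
      _ ≤ ℓ * m ^ (p / 2) + (p - 2) / 2 * 1 * D := by
          have : 0 ≤ (p - 2) / 2 := by linarith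
          gcongr
      _ ≤ ℓ * m ^ (p / 2) + p / 2 * D := by linarith
  have h := mul_le_mul_of_nonneg_left hmain (by positivity : 0 ≤ 1 / p)
  have e : 1 / p * (ℓ * m ^ (p / 2) + p / 2 * D) = ℓ / p * m ^ (p / 2) + 1 / 2 * D := by
    field_simp
  linarith
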